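/- Let a, b, f be positive real numbers and let c be a real number with a ≤ c. Then (a + a·b + a·f − b·f)·(b + a·b + b·c − a·c)/((1+b)·(1+c+f)) ≤ (a + a·b + a·f − b·f)·(b + 2·a·b − a²)/((1+b)·(1+a+f)). -/

import Mathlib

/-- The area `|AHB|` is a nonincreasing function of the parameter `c`; bounding it by
its value at `c = a` (using `c ≥ a`). -/
theorem AHB_bound (a b c f : ℝ) (ha : 0 < a) (hb : 0 < b) (hf : 0 < f) (hac : a ≤ c) :
    (a + a * b + a * f - b * f) * (b + a * b + b * c - a * c) / ((1 + b) * (1 + c + f)) ≤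
      (a + a * b + a * f - b * f) * (b + 2 * a * b - a ^ 2) / ((1 + b) * (1 + a + f)) := by
  have hc : 0 < c := ha.trans_le hac
  have key : (a + a * b + a * f - b * f) * (b + 2 * a * b - a ^ 2) / ((1 + b) * (1 + a + f)) -
      (a + a * b + a * f - b * f) * (b + a * b + b * c - a * c) / ((1 + b) * (1 + c + f)) =
      (a + a * b + a * f - b * f) ^ 2 * (c - a) / ((1 + b) * (1 + a + f) * (1 + c + f)) := by
    field_simp
    ring
  have hca : 0 ≤ c - a := sub_nonneg.2 hac
  rw [← sub_nonneg, key]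
  positivity
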